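/- arXiv:2212.05444 — 5 statements merged into one kernel-verified Lean document; each statement's English description precedes it below -/
import Mathlib

section
/- Let k be a field, n ≥ 1, Q = k[x₁,...,xₙ], and I a homogeneous Gorenstein ideal with (x₁,...,xₙ)⁴ ⊆ I ⊆ (x₁,...,xₙ)². If the class of x₁ in Q/I is a linear form of rank one and x₁² ∈ I, then, after a linear change of variables, the ideal I contains x₁², x₁x₂, ..., x₁x_{n−1}, and the dual generator F of I can be written as F = X₁X_n^{[2]} + G(X₂,...,X_n) for some cubic form G. -/
open MvPolynomial

/-- Contraction action of the polynomial ring on the divided power algebra,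
recorded in divided power coordinates: `x^s ∘ X^{[t]} = X^{[t−s]}` if `s ≤ t`,
and `0` otherwise, extended bilinearly. -/
noncomputable def contract {σ : Type*} {k : Type*} [CommSemiring k]
    (q F : MvPolynomial σ k) : MvPolynomial σ k :=
  letI := Classical.decEq σ
  letI : DecidablePred fun p : (σ →₀ ℕ) × (σ →₀ ℕ) => p.1 ≤ p.2 := fun _ => Classical.dec _
  ∑ s ∈ q.support, ∑ t ∈ F.support,
    if s ≤ t then MvPolynomial.monomial (t - s) (q.coeff s * F.coeff t) else 0

/-- The pairing of a polynomial with `F` in divided power coordinates. -/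
noncomputable def pairL {σ : Type*} {k : Type*} [Field k] (F : MvPolynomial σ k) :
    MvPolynomial σ k →ₗ[k] k :=
  ∑ t ∈ F.support, F.coeff t • lcoeff k t

lemma pairL_apply {σ : Type*} {k : Type*} [Field k] (F q : MvPolynomial σ k) :
    pairL F q = ∑ t ∈ F.support, F.coeff t * q.coeff t := by
  simp [pairL, LinearMap.sum_apply]

lemma pairL_monomial {σ : Type*} {k : Type*} [Field k] (F : MvPolynomial σ k) (s : σ →₀ ℕ) :
    pairL F (monomial s 1) = F.coeff s := by
  classical
  rw [pairL_apply]
  simp only [coeff_monomial, mul_ite, mul_one, mul_zero, Finset.sum_ite_eq]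
  split_ifs with h
  · rfl
  · simpa using (notMem_support_iff.mp h).symm

lemma coeff_contract {σ : Type*} {k : Type*} [Field k] (q F : MvPolynomial σ k) (u : σ →₀ ℕ) :
    (contract q F).coeff u = pairL F (monomial u 1 * q) := by
  classical
  rw [pairL_apply, contract]
  simp only [coeff_sum]
  rw [Finset.sum_comm]
  refine Finset.sum_congr rfl fun t _ => ?_
  rw [coeff_monomial_mul']
  by_cases hut : u ≤ t
  · rw [if_pos hut, Finset.sum_eq_single (t - u)]
    · have h1 : t - u ≤ t := tsub_le_self
      have h2 : t - (t - u) = u := tsub_tsub_cancel_of_le hut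
      rw [if_pos h1, h2]
      simp [mul_comm]
    · intro s _ hs
      split_ifs with h
      · rw [coeff_monomial, if_neg]
        rintro rfl
        exact hs (tsub_tsub_cancel_of_le h).symm
      · simp
    · intro h
      rw [notMem_support_iff.mp h]
      simp
  · rw [if_neg hut, mul_zero]
    refine Finset.sum_eq_zero fun s _ => ?_
    split_ifs with h
    · rw [coeff_monomial, if_neg]
      rintro rfl
      exact hut tsub_le_self
    · simp

lemma contract_eq_zero_iff {σ : Type*} {k : Type*} [Field k] (q F : MvPolynomial σ k) :
    contract q F = 0 ↔ ∀ p, pairL F (p * q) = 0 := by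
  constructor
  · intro h p
    induction p using MvPolynomial.induction_on' with
    | monomial u a =>
      have := coeff_contract q F u
      rw [h, coeff_zero] at this
      have e : monomial u a = a • monomial u (1 : k) := by simp [smul_monomial]
      rw [e, smul_mul_assoc, map_smul, ← this, smul_zero]
    | add p r hp hr => rw [add_mul, map_add, hp, hr, add_zero]
  · intro h
    ext u
    rw [coeff_contract, h, coeff_zero]

lemma pairL_of_homogeneous {σ : Type*} {k : Type*} [Field k] {F q : MvPolynomial σ k} {a b : ℕ}
    (hF : F.IsHomogeneous a) (hq : q.IsHomogeneous b) (hab : b ≠ a) : pairL F q = 0 := by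
  rw [pairL_apply]
  refine Finset.sum_eq_zero fun t ht => ?_
  have h1 := hF.degree_eq_sum_deg_support ht
  rw [hq.coeff_eq_zero, mul_zero]
  exact fun h => hab (h.symm.trans h1.symm)

/-- The shear `x_j ↦ x_j + a_j x_m`. -/
noncomputable def shearHom {n : ℕ} {k : Type*} [Field k] (a : Fin n → k) (m : Fin n) :
    MvPolynomial (Fin n) k →ₐ[k] MvPolynomial (Fin n) k :=
  aeval fun j => X j + C (a j) * X m

lemma shearHom_comp {n : ℕ} {k : Type*} [Field k] (a : Fin n → k) (m : Fin n) (ha : a m = 0) :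
    (shearHom a m).comp (shearHom (-a) m) = AlgHom.id k _ := by
  ext1 j
  simp only [shearHom, AlgHom.comp_apply, aeval_X, map_add, map_mul, algHom_C, ha,
    Pi.neg_apply, map_neg, AlgHom.id_apply, MvPolynomial.algebraMap_eq, map_zero]
  ring

noncomputable def shear {n : ℕ} {k : Type*} [Field k] (a : Fin n → k) (m : Fin n) (ha : a m = 0) :
    MvPolynomial (Fin n) k ≃ₐ[k] MvPolynomial (Fin n) k :=
  AlgEquiv.ofAlgHom (shearHom a m) (shearHom (-a) m) (shearHom_comp a m ha) (by
    have := shearHom_comp (-a) m (by simp [ha])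
    rwa [neg_neg] at this)

lemma shear_X {n : ℕ} {k : Type*} [Field k] (a : Fin n → k) (m : Fin n) (ha : a m = 0) (j) :
    shear a m ha (X j) = X j + C (a j) * X m := by
  simp [shear, shearHom]

lemma shear_symm_X {n : ℕ} {k : Type*} [Field k] (a : Fin n → k) (m : Fin n) (ha : a m = 0) (j) :
    (shear a m ha).symm (X j) = X j + C (-a j) * X m := by
  simp [shear, shearHom]

lemma hom_lin {n : ℕ} {k : Type*} [Field k] (i j : Fin n) (a : k) :
    (X i + C a * X j : MvPolynomial (Fin n) k).IsHomogeneous 1 := by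
  have := (isHomogeneous_C (Fin n) a).mul (isHomogeneous_X k j)
  rw [zero_add] at this
  exact (isHomogeneous_X k i).add this

lemma hom_monomial {n : ℕ} {k : Type*} [Field k]
    (θ : MvPolynomial (Fin n) k ≃ₐ[k] MvPolynomial (Fin n) k)
    (h : ∀ i, (θ (X i)).IsHomogeneous 1) (s : Fin n →₀ ℕ) :
    (θ (monomial s 1)).IsHomogeneous s.degree := by
  rw [monomial_eq, map_mul, C_1, map_one, one_mul, Finsupp.prod, map_prod, Finsupp.degree]
  refine IsHomogeneous.prod _ _ _ fun i _ => ?_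
  rw [map_pow]
  simpa using (h i).pow (s i)

/-- Proposition 3.1, case (1): if the class of `x₁` in `Q/I` is a rank-one
linear form and `x₁² ∈ I`, then after a linear change of variables `I` contains
`x₁², x₁x₂, …, x₁x_{n−1}` and the dual generator can be written as
`F = X₁Xₙ^{[2]} + G(X₂,…,Xₙ)`. -/
theorem stmt_4 (k : Type*) [Field k] (n : ℕ) (hn : 0 < n)
    (I : Ideal (MvPolynomial (Fin n) k))
    -- `I` is homogeneous
    (hIhom : ∀ p ∈ I, ∀ d : ℕ, homogeneousComponent d p ∈ I)
    -- `m⁴ ⊆ I ⊆ m²`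
    (hm4 : (Ideal.span (Set.range X)) ^ 4 ≤ I)
    (hm2 : I ≤ (Ideal.span (Set.range X)) ^ 2)
    -- `I` is Gorenstein with dual generator the cubic `F` (Macaulay duality)
    (F : MvPolynomial (Fin n) k) (hF : F.IsHomogeneous 3)
    (hann : ∀ q, q ∈ I ↔ contract q F = 0)
    -- the class of `x₁` in `Q/I` is a linear form of rank one:
    -- multiplication by `x₁` from `(Q/I)₁` to `(Q/I)₂` has rank one
    (hrank : Module.finrank k
      (LinearMap.range
        ((Ideal.Quotient.mkₐ k I).toLinearMap ∘ₗ
          LinearMap.mulLeft k (X (⟨0, hn⟩ : Fin n)) ∘ₗ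
          (∑ i : Fin n, (LinearMap.proj i : (Fin n → k) →ₗ[k] k).smulRight (X i)))) = 1)
    -- `x₁² ∈ I`
    (hx1 : (X (⟨0, hn⟩ : Fin n)) ^ 2 ∈ I) :
    ∃ ψ : MvPolynomial (Fin n) k ≃ₐ[k] MvPolynomial (Fin n) k,
      (∀ i, (ψ (X i)).IsHomogeneous 1) ∧
      (X (⟨0, hn⟩ : Fin n)) ^ 2 ∈ I.map ψ ∧
      (∀ j : Fin n, j ≠ ⟨0, hn⟩ → j ≠ ⟨n - 1, Nat.sub_lt hn one_pos⟩ →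
        X (⟨0, hn⟩ : Fin n) * X j ∈ I.map ψ) ∧
      ∃ G : MvPolynomial (Fin n) k, G.IsHomogeneous 3 ∧
        (∀ m ∈ G.support, m ⟨0, hn⟩ = 0) ∧
        (∀ q, q ∈ I.map ψ ↔
          contract q (monomial (Finsupp.single (⟨0, hn⟩ : Fin n) 1 +
            Finsupp.single (⟨n - 1, Nat.sub_lt hn one_pos⟩ : Fin n) 2) 1 + G) = 0) := by
  classical
  set z : Fin n := ⟨0, hn⟩ with hz
  set l : Fin n := ⟨n - 1, Nat.sub_lt hn one_pos⟩ with hl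
  obtain ⟨v, hv0, hv⟩ := finrank_eq_one_iff'.mp hrank
  -- coordinates of the images of the variables
  have hc : ∀ i : Fin n, ∃ c : k, c • (v : MvPolynomial (Fin n) k ⧸ I) =
      Ideal.Quotient.mk I (X z * X i) := by
    intro i
    obtain ⟨c, hc⟩ := hv ⟨_, ⟨Pi.single i 1, rfl⟩⟩
    refine ⟨c, ?_⟩
    have := congrArg Subtype.val hc
    simpa [LinearMap.sum_apply, Pi.single_apply] using this
  choose c hc using hc
  have hv0' : (v : MvPolynomial (Fin n) k ⧸ I) ≠ 0 := fun h => hv0 (Subtype.ext h)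
  have hc0 : ∀ i, c i = 0 ↔ X z * X i ∈ I := by
    intro i
    rw [← Ideal.Quotient.eq_zero_iff_mem, ← hc, smul_eq_zero]
    simp [hv0']
  have hcz : c z = 0 := by rw [hc0, ← pow_two]; exact hx1
  obtain ⟨m, hm⟩ : ∃ m, c m ≠ 0 := by
    by_contra! hall
    obtain ⟨w, hw⟩ := v.2
    apply hv0'
    rw [← hw]
    simp only [LinearMap.comp_apply, LinearMap.sum_apply, map_sum]
    refine Finset.sum_eq_zero fun i _ => ?_
    have := (hc0 i).mp (hall i)
    rw [← Ideal.Quotient.eq_zero_iff_mem] at this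
    simp only [LinearMap.smulRight_apply, map_smul, LinearMap.mulLeft_apply]
    rw [show (Ideal.Quotient.mkₐ k I).toLinearMap (X z * X i) = 0 from this, smul_zero]
  have hzm : z ≠ m := by rintro h; exact hm (h ▸ hcz)
  have hzl : z ≠ l := by
    intro h
    apply hzm
    rw [hz, hl, Fin.mk.injEq] at h
    ext
    have := m.2
    simp only [hz]
    omega
  let a : Fin n → k := fun i => if i = m then 0 else - (c i / c m)
  have ha : a m = 0 := by simp [a]
  let σ : Equiv.Perm (Fin n) := Equiv.swap m l
  let θ : MvPolynomial (Fin n) k ≃ₐ[k] MvPolynomial (Fin n) k :=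
    (renameEquiv k σ).trans (shear a m ha)
  have hθX : ∀ j, θ (X j) = X (σ j) + C (a (σ j)) * X m := by
    intro j
    simp [θ, shear_X]
  have hθz : θ (X z) = X z := by
    rw [hθX]
    have : σ z = z := Equiv.swap_apply_of_ne_of_ne hzm hzl
    rw [this]
    simp [a, hzm, hcz]
  have hθl : θ (X l) = X m := by
    rw [hθX]
    have : σ l = m := Equiv.swap_apply_right m l
    rw [this]
    simp [a]
  have hθj : ∀ j, j ≠ l → θ (X z * X j) ∈ I := by
    intro j hj
    rw [map_mul, hθz, hθX]
    have hσ : σ j ≠ m := by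
      intro h
      apply hj
      apply σ.injective
      rw [h]
      exact (Equiv.swap_apply_right m l).symm
    rw [← Ideal.Quotient.eq_zero_iff_mem]
    have e : (X z * (X (σ j) + C (a (σ j)) * X m) : MvPolynomial (Fin n) k) =
      X z * X (σ j) + (a (σ j)) • (X z * X m) := by
      rw [smul_eq_C_mul]; ring
    rw [e, map_add]
    have e2 : Ideal.Quotient.mk I ((a (σ j)) • (X z * X m)) =
      (a (σ j)) • Ideal.Quotient.mk I (X z * X m) := rfl
    rw [e2, ← hc, ← hc, smul_smul, ← add_smul]
    have : c (σ j) + a (σ j) * c m = 0 := by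
      simp only [a, if_neg hσ]
      field_simp
      ring
    rw [this, zero_smul]
  have hθhom : ∀ i, (θ (X i)).IsHomogeneous 1 := by
    intro i; rw [hθX]; exact hom_lin _ _ _
  have hI : ∀ q, q ∈ I ↔ ∀ p, pairL F (p * q) = 0 := fun q =>
    (hann q).trans (contract_eq_zero_iff q F)
  have hmap : ∀ q, q ∈ I.map θ.symm ↔ θ q ∈ I := by
    intro q
    constructor
    · intro h
      rw [Ideal.mem_map_of_equiv] at h
      obtain ⟨x, hx, rfl⟩ := h
      simpa using hx
    · intro h
      have := Ideal.mem_map_of_mem θ.symm h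
      simpa using this
  -- the transported functional
  have H3 : ∀ s : Fin n →₀ ℕ, s.degree ≠ 3 → pairL F (θ (monomial s 1)) = 0 := fun s hs =>
    pairL_of_homogeneous hF (hom_monomial θ hθhom s) hs
  set s0 : Fin n →₀ ℕ := Finsupp.single z 1 + Finsupp.single l 2 with hs0
  have H0 : ∀ s : Fin n →₀ ℕ, s z ≠ 0 → s ≠ s0 → pairL F (θ (monomial s 1)) = 0 := by
    intro s hsz hs
    by_cases hd : s.degree = 3
    · have hle : Finsupp.single z 1 ≤ s := by
        rw [Finsupp.single_le_iff]; omega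
      obtain ⟨t, rfl⟩ := exists_add_of_le hle
      by_cases hj : ∃ j, j ≠ l ∧ t j ≠ 0
      · obtain ⟨j, hjl, hj⟩ := hj
        have hle : Finsupp.single j 1 ≤ t := by
          rw [Finsupp.single_le_iff]; omega
        obtain ⟨r, rfl⟩ := exists_add_of_le hle
        have e : (monomial (Finsupp.single z 1 + (Finsupp.single j 1 + r)) 1 :
            MvPolynomial (Fin n) k) = monomial r 1 * (X z * X j) := by
          simp only [X, monomial_mul, mul_one]
          congr 1
          abel_nf
        rw [e, map_mul]
        exact (hI _).mp (hθj j hjl) _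
      · push Not at hj
        exfalso
        apply hs
        have ht : t = Finsupp.single l (t l) := by
          ext j
          by_cases h : j = l
          · simp [h]
          · rw [hj j h, Finsupp.single_apply, if_neg (Ne.symm h)]
        rw [map_add, ht] at hd
        simp only [Finsupp.degree_single] at hd
        have : t l = 2 := by omega
        rw [hs0, ht, this]
    · exact H3 s hd
  set d : k := pairL F (θ (monomial s0 1)) with hd
  have hd0 : d ≠ 0 := by
    intro h0
    apply hm
    rw [hc0, hI]
    have key : ∀ p, pairL F (θ (p * (X z * X l))) = 0 := by
      intro p
      induction p using MvPolynomial.induction_on' with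
      | monomial u b =>
        have e : monomial u b * (X z * X l) =
            b • monomial (u + (Finsupp.single z 1 + Finsupp.single l 1)) (1 : k) := by
          simp [X, monomial_mul, smul_monomial]
        rw [e, map_smul, map_smul]
        by_cases hs : u + (Finsupp.single z 1 + Finsupp.single l 1) = s0
        · rw [hs, ← hd, h0, smul_zero]
        · rw [H0 _ (by simp) hs, smul_zero]
      | add p r hp hr => rw [add_mul, map_add, map_add, hp, hr, add_zero]
    intro p
    have := key (θ.symm p)
    rwa [map_mul θ, map_mul θ, hθz, hθl, AlgEquiv.apply_symm_apply] at this
  have hS : ∀ s : Fin n →₀ ℕ, s ∈ Finset.finsuppAntidiag Finset.univ 3 ↔ s.degree = 3 := by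
    intro s
    simp [Finset.mem_finsuppAntidiag, Finsupp.degree_eq_sum]
  let G : MvPolynomial (Fin n) k :=
    ∑ s ∈ (Finset.finsuppAntidiag (Finset.univ : Finset (Fin n)) 3).filter (fun s => s z = 0),
      monomial s (d⁻¹ * pairL F (θ (monomial s 1)))
  have hGc : ∀ s, G.coeff s = if s.degree = 3 ∧ s z = 0 then
      d⁻¹ * pairL F (θ (monomial s 1)) else 0 := by
    intro s
    simp only [G, coeff_sum, coeff_monomial, Finset.sum_ite_eq', Finset.mem_filter, hS]
  refine ⟨θ.symm, ?_, ?_, ?_, G, ?_, ?_, ?_⟩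
  · intro i
    have : θ.symm (X i) = X (σ.symm i) + C (-a i) * X (σ.symm m) := by
      simp [θ, shear_symm_X]
    rw [this]
    exact hom_lin _ _ _
  · rw [hmap, pow_two]
    exact hθj z hzl
  · intro j _ hj
    rw [hmap]
    exact hθj j hj
  · intro s hs
    rw [hGc] at hs
    have : s.degree = 3 := by
      by_contra h
      simp [h] at hs
    rwa [Finsupp.degree_eq_weight_one] at this
  · intro s hs
    rw [mem_support_iff, hGc] at hs
    by_contra h
    simp [h] at hs
  · have hco : ∀ s, coeff s (monomial s0 1 + G) = d⁻¹ * pairL F (θ (monomial s 1)) := by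
      intro s
      rw [coeff_add, coeff_monomial, hGc]
      by_cases hs : s0 = s
      · subst hs
        have : s0 z ≠ 0 := by simp [hs0]
        rw [if_pos rfl, if_neg (fun h => this h.2), add_zero, ← hd, inv_mul_cancel₀ hd0]
      · rw [if_neg hs, zero_add]
        split_ifs with h
        · rfl
        · by_cases h3 : s.degree = 3
          · rw [H0 s (fun hz => h ⟨h3, hz⟩) (Ne.symm hs), mul_zero]
          · rw [H3 s h3, mul_zero]
    have hp : ∀ p, pairL (monomial s0 1 + G) p = d⁻¹ * pairL F (θ p) := by
      intro p
      induction p using MvPolynomial.induction_on' with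
      | monomial u b =>
        have e : monomial u b = b • monomial u (1 : k) := by simp [smul_monomial]
        rw [e, map_smul, map_smul, map_smul, pairL_monomial, hco, smul_eq_mul, smul_eq_mul]
        ring
      | add p r hp hr => rw [map_add, map_add, map_add, hp, hr, mul_add]
    intro q
    rw [hmap, hI, contract_eq_zero_iff]
    constructor
    · intro h p
      rw [hp, map_mul, h, mul_zero]
    · intro h p
      have := h (θ.symm p)
      rw [hp, map_mul, AlgEquiv.apply_symm_apply] at this
      exact (mul_eq_zero.mp this).resolve_left (inv_ne_zero hd0)
end

section
/- In Q = k[x,y,z,w] over a field k of characteristic zero, for F = X^{[3]} + XYZ + XYW + XZW + YZW in the divided power algebra, the annihilator of F is the quadratic ideal (2x²+xw−yw−zw, xy−yz−xw+zw, xz−yz−xw+yw, y², z², w²). -/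
open MvPolynomial

/-- Exponent vector. -/
noncomputable def ev (a b c d : ℕ) : Fin 4 →₀ ℕ := Finsupp.equivFunOnFinite.symm ![a, b, c, d]

theorem ev_inj (a b c d a' b' c' d' : ℕ) :
    ev a b c d = ev a' b' c' d' ↔ a = a' ∧ b = b' ∧ c = c' ∧ d = d' := by
  simp [ev]

theorem ev_add (a b c d a' b' c' d' : ℕ) :
    ev a b c d + ev a' b' c' d' = ev (a + a') (b + b') (c + c') (d + d') := by
  ext i; fin_cases i <;> simp [ev]

theorem ev_surj (s : Fin 4 →₀ ℕ) : s = ev (s 0) (s 1) (s 2) (s 3) := by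
  ext i; fin_cases i <;> simp [ev]

/-- The monomial with given exponents. -/
noncomputable def Mo (k : Type*) [Field k] (a b c d : ℕ) : MvPolynomial (Fin 4) k :=
  monomial (ev a b c d) 1

theorem Mo_mul (k : Type*) [Field k] (a b c d a' b' c' d' : ℕ) :
    Mo k a b c d * Mo k a' b' c' d' = Mo k (a + a') (b + b') (c + c') (d + d') := by
  simp [Mo, monomial_mul, ev_add]

theorem X0_eq (k : Type*) [Field k] : (X 0 : MvPolynomial (Fin 4) k) = Mo k 1 0 0 0 := by
  unfold Mo X; congr 1; rw [ev_surj (Finsupp.single 0 1)]; simp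
theorem X1_eq (k : Type*) [Field k] : (X 1 : MvPolynomial (Fin 4) k) = Mo k 0 1 0 0 := by
  unfold Mo X; congr 1; rw [ev_surj (Finsupp.single 1 1)]; simp
theorem X2_eq (k : Type*) [Field k] : (X 2 : MvPolynomial (Fin 4) k) = Mo k 0 0 1 0 := by
  unfold Mo X; congr 1; rw [ev_surj (Finsupp.single 2 1)]; simp
theorem X3_eq (k : Type*) [Field k] : (X 3 : MvPolynomial (Fin 4) k) = Mo k 0 0 0 1 := by
  unfold Mo X; congr 1; rw [ev_surj (Finsupp.single 3 1)]; simp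

/-- The pairing with `F`. -/
noncomputable def pairF (k : Type*) [Field k] : MvPolynomial (Fin 4) k →ₗ[k] k :=
  lcoeff k (ev 3 0 0 0) + lcoeff k (ev 1 1 1 0) + lcoeff k (ev 1 1 0 1) +
    lcoeff k (ev 1 0 1 1) + lcoeff k (ev 0 1 1 1)

theorem pairF_Mo (k : Type*) [Field k] (a b c d : ℕ) : pairF k (Mo k a b c d) =
    (if a = 3 ∧ b = 0 ∧ c = 0 ∧ d = 0 then 1 else 0) +
    (if a = 1 ∧ b = 1 ∧ c = 1 ∧ d = 0 then 1 else 0) +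
    (if a = 1 ∧ b = 1 ∧ c = 0 ∧ d = 1 then 1 else 0) +
    (if a = 1 ∧ b = 0 ∧ c = 1 ∧ d = 1 then 1 else 0) +
    (if a = 0 ∧ b = 1 ∧ c = 1 ∧ d = 1 then 1 else 0) := by
  simp [pairF, Mo, coeff_monomial, ev_inj]

theorem contract_coeff {σ k : Type*} [Field k] (q F : MvPolynomial σ k) (u : σ →₀ ℕ) :
    (contract q F).coeff u = ∑ t ∈ F.support, (q * monomial u 1).coeff t * F.coeff t := by
  classical
  unfold contract
  simp only [coeff_sum]
  rw [Finset.sum_comm]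
  refine Finset.sum_congr rfl fun t _ => ?_
  rw [coeff_mul_monomial']
  by_cases h : u ≤ t
  · rw [if_pos h, mul_one, Finset.sum_eq_single (t - u)]
    · rw [if_pos tsub_le_self, coeff_monomial, if_pos (tsub_tsub_cancel_of_le h)]
    · intro s _ hs
      split_ifs with h2
      · rw [coeff_monomial, if_neg]
        intro h3
        apply hs
        rw [← h3, tsub_tsub_cancel_of_le h2]
      · simp
    · intro hs
      rw [notMem_support_iff] at hs
      simp [hs]
  · rw [if_neg h, zero_mul]
    refine Finset.sum_eq_zero fun s _ => ?_
    split_ifs with h2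
    · rw [coeff_monomial, if_neg]
      intro h3
      exact h (h3 ▸ tsub_le_self)
    · simp

theorem sum_pair {σ k : Type*} [Field k] (p F : MvPolynomial σ k) :
    ∑ t ∈ F.support, p.coeff t * F.coeff t = ∑ t ∈ p.support, p.coeff t * F.coeff t := by
  classical
  rw [Finset.sum_subset (Finset.subset_union_left (s₂ := p.support)),
    Finset.sum_subset (Finset.subset_union_right (s₁ := F.support) (s₂ := p.support))]
  · intro t _ ht
    rw [notMem_support_iff.1 ht, zero_mul]
  · intro t _ ht
    rw [notMem_support_iff.1 ht, mul_zero]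

/-- The form `F`. -/
noncomputable def FF (k : Type*) [Field k] : MvPolynomial (Fin 4) k :=
  Mo k 3 0 0 0 + Mo k 1 1 1 0 + Mo k 1 1 0 1 + Mo k 1 0 1 1 + Mo k 0 1 1 1

theorem contract_iff {k : Type*} [Field k] (q : MvPolynomial (Fin 4) k) :
    contract q (FF k) = 0 ↔ ∀ a b c d, pairF k (q * Mo k a b c d) = 0 := by
  have key : ∀ u, (contract q (FF k)).coeff u = pairF k (q * monomial u 1) := by
    intro u
    rw [contract_coeff, sum_pair, FF]
    have hmon : ∀ (p : MvPolynomial (Fin 4) k) (a b c d : ℕ),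
        (∑ t ∈ p.support, p.coeff t * (Mo k a b c d).coeff t) = p.coeff (ev a b c d) := by
      intro p a b c d
      classical
      unfold Mo
      simp only [coeff_monomial, mul_ite, mul_one, mul_zero, Finset.sum_ite_eq]
      split_ifs with h
      · rfl
      · exact (notMem_support_iff.1 h).symm
    simp only [coeff_add, mul_add, Finset.sum_add_distrib, hmon]
    simp [pairF]
  constructor
  · intro h a b c d
    have := key (ev a b c d)
    rw [h] at this
    simpa [Mo] using this.symm
  · intro h
    ext u
    rw [key, ev_surj u]
    simpa [Mo] using h (u 0) (u 1) (u 2) (u 3)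

theorem pair_gen {k : Type*} [Field k] (g : MvPolynomial (Fin 4) k)
    (h : ∀ a b c d, pairF k (Mo k a b c d * g) = 0) (p : MvPolynomial (Fin 4) k) :
    pairF k (p * g) = 0 := by
  induction p using MvPolynomial.induction_on' with
  | monomial u a =>
    have : monomial u a = a • Mo k (u 0) (u 1) (u 2) (u 3) := by
      rw [Mo, ← ev_surj, smul_monomial, smul_eq_mul, mul_one]
    rw [this, smul_mul_assoc, map_smul, h, smul_zero]
  | add p q hp hq => rw [add_mul, map_add, hp, hq, add_zero]

set_option maxHeartbeats 8000000 in
theorem pair_gens {k : Type*} [Field k] (g : MvPolynomial (Fin 4) k)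
    (hg : g ∈ ({2 * Mo k 1 0 0 0 ^ 2 + Mo k 1 0 0 0 * Mo k 0 0 0 1 - Mo k 0 1 0 0 * Mo k 0 0 0 1
        - Mo k 0 0 1 0 * Mo k 0 0 0 1,
      Mo k 1 0 0 0 * Mo k 0 1 0 0 - Mo k 0 1 0 0 * Mo k 0 0 1 0 - Mo k 1 0 0 0 * Mo k 0 0 0 1
        + Mo k 0 0 1 0 * Mo k 0 0 0 1,
      Mo k 1 0 0 0 * Mo k 0 0 1 0 - Mo k 0 1 0 0 * Mo k 0 0 1 0 - Mo k 1 0 0 0 * Mo k 0 0 0 1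
        + Mo k 0 1 0 0 * Mo k 0 0 0 1,
      Mo k 0 1 0 0 ^ 2, Mo k 0 0 1 0 ^ 2, Mo k 0 0 0 1 ^ 2} : Set (MvPolynomial (Fin 4) k)))
    (a b c d : ℕ) : pairF k (Mo k a b c d * g) = 0 := by
  simp only [Set.mem_insert_iff, Set.mem_singleton_iff] at hg
  rcases hg with rfl | rfl | rfl | rfl | rfl | rfl <;>
  simp only [pow_two, two_mul, mul_add, mul_sub, Mo_mul, map_add, map_sub,
    pairF_Mo] <;>
  rcases a with _ | _ | a <;> rcases b with _ | _ | b <;> rcases c with _ | _ | c <;>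
  rcases d with _ | _ | d <;> simp

/-- The normal form. -/
def nf {A : Type*} [CommRing A] (x y z w : A) (c0 c1 c2 c3 c4 c5 c6 c7 c8 c9 : A) : A :=
  c0 + c1 * x + c2 * y + c3 * z + c4 * w + c5 * (x * w) + c6 * (y * z) + c7 * (y * w)
    + c8 * (z * w) + c9 * (y * z * w)

theorem reduce {k A : Type*} [Field k] [CharZero k] [CommRing A] (φ : k →+* A) (x y z w : A)
    (h1 : 2 * x ^ 2 + x * w - y * w - z * w = 0)
    (h2 : x * y - y * z - x * w + z * w = 0)
    (h3 : x * z - y * z - x * w + y * w = 0)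
    (hy : y ^ 2 = 0) (hz : z ^ 2 = 0) (hw : w ^ 2 = 0)
    (c0 c1 c2 c3 c4 c5 c6 c7 c8 c9 : k) (v : A) (hv : v = x ∨ v = y ∨ v = z ∨ v = w) :
    ∃ d0 d1 d2 d3 d4 d5 d6 d7 d8 d9 : k,
      nf x y z w (φ c0) (φ c1) (φ c2) (φ c3) (φ c4) (φ c5) (φ c6) (φ c7) (φ c8) (φ c9) * v =
      nf x y z w (φ d0) (φ d1) (φ d2) (φ d3) (φ d4) (φ d5) (φ d6) (φ d7) (φ d8) (φ d9) := by
  have hh : φ (1 / 2) * 2 = 1 := by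
    rw [← map_ofNat φ 2, ← map_mul]; simp
  set h := φ (1 / 2) with hdef
  have xx : x ^ 2 = h * (y * w + z * w - x * w) := by
    linear_combination h * h1 - x ^ 2 * hh
  have xyw : x * y * w = y * z * w := by
    linear_combination w * h2 + x * hw - z * hw
  have xzw : x * z * w = y * z * w := by
    linear_combination w * h3 + x * hw - y * hw
  have xyz : x * y * z = y * z * w := by
    linear_combination z * h2 + y * hz - w * hz + xzw
  have xxw : x ^ 2 * w = 0 := by
    linear_combination w * xx + h * (y + z - x) * hw
  have xxy : x ^ 2 * y = 0 := by
    linear_combination y * xx + h * w * hy - h * xyw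
  have xxz : x ^ 2 * z = 0 := by
    linear_combination z * xx + h * w * hz - h * xzw
  have tx : y * z * w * x = 0 := by
    linear_combination y * xzw + z * w * hy
  rcases hv with rfl | rfl | rfl | rfl
  · refine ⟨0, c0, 0, 0, 0, -(1/2) * c1 + c2 + c3 + c4, c2 + c3, (1/2) * c1 - c3, (1/2) * c1 - c2,
      c6 + c7 + c8, ?_⟩
    simp only [nf, map_add, map_sub, map_mul, map_neg, map_zero, ← hdef]
    linear_combination φ c1 * xx + φ c2 * h2 + φ c3 * h3 + φ c5 * xxw + φ c6 * xyz + φ c7 * xyw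
      + φ c8 * xzw + φ c9 * tx
  · refine ⟨0, 0, c0, 0, 0, c1, c1 + c3, c4, - c1, c5 + c8, ?_⟩
    simp only [nf, map_add, map_neg, map_zero]
    linear_combination φ c1 * h2 + φ c2 * hy + φ c5 * xyw + φ c6 * z * hy + φ c7 * w * hy
      + φ c9 * z * w * hy
  · refine ⟨0, 0, 0, c0, 0, c1, c1 + c2, - c1, c4, c5 + c7, ?_⟩
    simp only [nf, map_add, map_neg, map_zero]
    linear_combination φ c1 * h3 + φ c3 * hz + φ c5 * xzw + φ c6 * y * hz + φ c8 * w * hz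
      + φ c9 * y * w * hz
  · refine ⟨0, 0, 0, 0, c0, c1, 0, c2, c3, c6, ?_⟩
    simp only [nf, map_zero]
    linear_combination (φ c4 + φ c5 * x + φ c7 * y + φ c8 * z + φ c9 * y * z) * hw

set_option maxHeartbeats 4000000 in
open Finsupp in
/-- over a field of characteristic zero, the annihilator of
`F = X^{[3]} + XYZ + XYW + XZW + YZW` is the stated quadratic ideal. -/
theorem stmt_7 (k : Type*) [Field k] [CharZero k] :
    let x : MvPolynomial (Fin 4) k := X 0
    let y : MvPolynomial (Fin 4) k := X 1
    let z : MvPolynomial (Fin 4) k := X 2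
    let w : MvPolynomial (Fin 4) k := X 3
    -- F = X^{[3]} + XYZ + XYW + XZW + YZW in divided power coordinates
    let F : MvPolynomial (Fin 4) k :=
      monomial (Finsupp.single 0 3) 1 +
      monomial (Finsupp.single 0 1 + Finsupp.single 1 1 + Finsupp.single 2 1) 1 +
      monomial (Finsupp.single 0 1 + Finsupp.single 1 1 + Finsupp.single 3 1) 1 +
      monomial (Finsupp.single 0 1 + Finsupp.single 2 1 + Finsupp.single 3 1) 1 +
      monomial (Finsupp.single 1 1 + Finsupp.single 2 1 + Finsupp.single 3 1) 1
    ∀ q : MvPolynomial (Fin 4) k,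
      contract q F = 0 ↔
        q ∈ Ideal.span {2 * x ^ 2 + x * w - y * w - z * w,
                        x * y - y * z - x * w + z * w,
                        x * z - y * z - x * w + y * w,
                        y ^ 2, z ^ 2, w ^ 2} := by
  intro x y z w F q
  have hF : F = FF k := by
    have e0 : Finsupp.single (0 : Fin 4) 3 = ev 3 0 0 0 := by
      ext i; fin_cases i <;> simp [ev]
    have e1 : Finsupp.single (0 : Fin 4) 1 = ev 1 0 0 0 := by
      ext i; fin_cases i <;> simp [ev]
    have e2 : Finsupp.single (1 : Fin 4) 1 = ev 0 1 0 0 := by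
      ext i; fin_cases i <;> simp [ev]
    have e3 : Finsupp.single (2 : Fin 4) 1 = ev 0 0 1 0 := by
      ext i; fin_cases i <;> simp [ev]
    have e4 : Finsupp.single (3 : Fin 4) 1 = ev 0 0 0 1 := by
      ext i; fin_cases i <;> simp [ev]
    simp only [F, FF, Mo, e0, e1, e2, e3, e4, ev_add]
  have hx : x = Mo k 1 0 0 0 := X0_eq k
  have hy : y = Mo k 0 1 0 0 := X1_eq k
  have hz : z = Mo k 0 0 1 0 := X2_eq k
  have hw : w = Mo k 0 0 0 1 := X3_eq k
  rw [hF, contract_iff]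
  clear_value F
  set I := Ideal.span {2 * x ^ 2 + x * w - y * w - z * w,
                        x * y - y * z - x * w + z * w,
                        x * z - y * z - x * w + y * w,
                        y ^ 2, z ^ 2, w ^ 2} with hI
  have hL : ∀ p ∈ I, pairF k p = 0 := by
    intro p hp
    refine Submodule.span_induction (p := fun p _ => ∀ r, pairF k (r * p) = 0) ?_ ?_ ?_ ?_ hp 1
      |> fun h => by simpa using h
    · intro g hg
      apply pair_gen
      intro a b c d
      rw [hx, hy, hz, hw] at hg
      exact pair_gens g hg a b c d
    · simp
    · intro a b _ _ ha hb r
      rw [mul_add, map_add, ha, hb, add_zero]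
    · intro a b _ hb r
      rw [smul_eq_mul, ← mul_assoc, hb]
  constructor
  swap
  · intro hq a b c d
    exact hL _ (I.mul_mem_right _ hq)
  intro hq
  have hnf : ∃ d0 d1 d2 d3 d4 d5 d6 d7 d8 d9 : k, Ideal.Quotient.mk I q = Ideal.Quotient.mk I
      (nf x y z w (C d0) (C d1) (C d2) (C d3) (C d4) (C d5) (C d6) (C d7) (C d8) (C d9)) := by
    clear hq
    induction q using MvPolynomial.induction_on with
    | C a => exact ⟨a, 0, 0, 0, 0, 0, 0, 0, 0, 0, by simp [nf]⟩
    | add p q hp hq =>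
      obtain ⟨c0, c1, c2, c3, c4, c5, c6, c7, c8, c9, hc⟩ := hp
      obtain ⟨d0, d1, d2, d3, d4, d5, d6, d7, d8, d9, hd⟩ := hq
      refine ⟨c0 + d0, c1 + d1, c2 + d2, c3 + d3, c4 + d4, c5 + d5, c6 + d6, c7 + d7, c8 + d8,
        c9 + d9, ?_⟩
      rw [map_add, hc, hd, ← map_add]
      congr 1
      simp only [nf, C_add]
      ring
    | mul_X p i hp =>
      obtain ⟨c0, c1, c2, c3, c4, c5, c6, c7, c8, c9, hc⟩ := hp
      have hm : ∀ g ∈ ({2 * x ^ 2 + x * w - y * w - z * w,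
                        x * y - y * z - x * w + z * w,
                        x * z - y * z - x * w + y * w,
                        y ^ 2, z ^ 2, w ^ 2} : Set (MvPolynomial (Fin 4) k)),
          Ideal.Quotient.mk I g = 0 := fun g hg =>
        Ideal.Quotient.eq_zero_iff_mem.2 (Ideal.subset_span hg)
      have e1 := hm (2 * x ^ 2 + x * w - y * w - z * w) (by simp)
      have e2 := hm (x * y - y * z - x * w + z * w) (by simp)
      have e3 := hm (x * z - y * z - x * w + y * w) (by simp)
      have e4 := hm (y ^ 2) (by simp)
      have e5 := hm (z ^ 2) (by simp)
      have e6 := hm (w ^ 2) (by simp)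
      simp only [map_add, map_sub, map_mul, map_pow, map_ofNat] at e1 e2 e3 e4 e5 e6
      obtain ⟨d0, d1, d2, d3, d4, d5, d6, d7, d8, d9, hd⟩ :=
        reduce ((Ideal.Quotient.mk I).comp C) _ _ _ _ e1 e2 e3 e4 e5 e6
          c0 c1 c2 c3 c4 c5 c6 c7 c8 c9 (Ideal.Quotient.mk I (X i))
          (by fin_cases i <;> simp [x, y, z, w])
      refine ⟨d0, d1, d2, d3, d4, d5, d6, d7, d8, d9, ?_⟩
      rw [map_mul, hc]
      simpa only [nf, map_add, map_mul, RingHom.comp_apply] using hd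
  obtain ⟨d0, d1, d2, d3, d4, d5, d6, d7, d8, d9, hd⟩ := hnf
  have hd2 := Ideal.Quotient.eq.1 hd
  have hn : ∀ a b c d, pairF k (nf x y z w (C d0) (C d1) (C d2) (C d3) (C d4) (C d5) (C d6) (C d7)
      (C d8) (C d9) * Mo k a b c d) = 0 := by
    intro a b c d
    have h1 := hL _ (I.mul_mem_right (Mo k a b c d) hd2)
    rw [sub_mul, map_sub, hq, zero_sub, neg_eq_zero] at h1
    exact h1
  have h1' : (C d0 : MvPolynomial (Fin 4) k) = C d0 * Mo k 0 0 0 0 := by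
    have : Mo k 0 0 0 0 = 1 := by
      unfold Mo
      have : ev 0 0 0 0 = 0 := by ext i; fin_cases i <;> simp [ev]
      rw [this]; rfl
    rw [this, mul_one]
  simp only [nf] at hn
  rw [h1'] at hn
  simp only [hx, hy, hz, hw, add_mul, mul_assoc, Mo_mul, map_add, C_mul', smul_mul_assoc,
    map_smul, pairF_Mo, smul_eq_mul] at hn
  have q0 := hn 0 1 1 1
  have q1 := hn 2 0 0 0
  have q2 := hn 1 1 0 0
  have q3 := hn 1 0 1 0
  have q4 := hn 1 0 0 1
  have q5 := hn 1 0 0 0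
  have q6 := hn 0 1 0 0
  have q7 := hn 0 0 1 0
  have q8 := hn 0 0 0 1
  have q9 := hn 0 0 0 0
  norm_num at q0 q1 q2 q3 q4 q5 q6 q7 q8 q9
  have two : (2 : k) ≠ 0 := two_ne_zero
  have r2 : d2 = 0 := by
    apply (mul_eq_zero.1 (?_ : 2 * d2 = 0)).resolve_left two
    linear_combination q3 + q4 - q2
  have r3 : d3 = 0 := by linear_combination q4 - r2
  have r4 : d4 = 0 := by linear_combination q3 - r2
  have r6 : d6 = 0 := by linear_combination q8
  have r5 : d5 = 0 := by
    apply (mul_eq_zero.1 (?_ : 2 * d5 = 0)).resolve_left two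
    linear_combination q6 + q7 - q5 + r6
  have r8 : d8 = 0 := by linear_combination q6 - r5
  have r7 : d7 = 0 := by linear_combination q7 - r5
  rw [← Ideal.Quotient.eq_zero_iff_mem, hd]
  subst r2 r3 r4 r5 r6 r7 r8
  simp_all [nf]
end

section
/- Let k be a field and Q = k[x,y,z,w]. The ideal J = (x², xz, xw, yz+a²z²−azw−w², yw−aw²) (a ∈ k) is a grade three perfect ideal of Q, and Q/J has a graded minimal free resolution of format (1,5,6,2): 0 → Q(−5)⊕Q(−4) → Q(−4)⊕Q⁵(−3) → Q⁵(−2) → Q, with differentials given by the explicit matrices in terms of A = y−aw, B = 0, C = −az−w, D = −y−a²z, T₁, T₂, T₅. -/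
open MvPolynomial

lemma mem_of_aeval {k : Type*} [Field k] (I : Ideal (MvPolynomial (Fin 4) k))
    (g : Fin 4 → MvPolynomial (Fin 4) k) (h : ∀ i, X i - g i ∈ I)
    (f : MvPolynomial (Fin 4) k) (hf : aeval g f = 0) : f ∈ I := by
  have key : (Ideal.Quotient.mkₐ k I).comp (aeval g) = Ideal.Quotient.mkₐ k I := by
    apply MvPolynomial.algHom_ext
    intro i
    simp only [AlgHom.comp_apply, aeval_X, Ideal.Quotient.mkₐ_eq_mk]
    exact (Ideal.Quotient.eq.2 (h i)).symm
  have := DFunLike.congr_fun key f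
  simp only [AlgHom.comp_apply, hf, map_zero, Ideal.Quotient.mkₐ_eq_mk] at this
  exact Ideal.Quotient.eq_zero_iff_mem.1 this.symm

/-- The ideal `(p, q)` with a retraction `g` is prime, and `T` is not in it. -/
lemma pair_prime {k : Type*} [Field k] (p q : MvPolynomial (Fin 4) k)
    (g : Fin 4 → MvPolynomial (Fin 4) k) (h : ∀ i, X i - g i ∈ Ideal.span {p, q})
    (hp : aeval g p = 0) (hq : aeval g q = 0)
    (T f : MvPolynomial (Fin 4) k) (hT : aeval g T ≠ 0)
    (u v : MvPolynomial (Fin 4) k) (hf : T * f = u * p + v * q) :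
    ∃ c d, f = c * p + d * q := by
  have h1 := congrArg (aeval g) hf
  simp only [map_mul, map_add, hp, hq, mul_zero, add_zero] at h1
  have h2 : aeval g f = 0 := (mul_eq_zero.1 h1).resolve_left hT
  obtain ⟨c, d, hcd⟩ := Ideal.mem_span_pair.1 (mem_of_aeval _ g h f h2)
  exact ⟨c, d, hcd.symm⟩

lemma prime_X0 {k : Type*} [Field k] (T f : MvPolynomial (Fin 4) k)
    (hT : eval ![0, 0, 0, 1] T ≠ 0) (h : X 0 ∣ T * f) : X 0 ∣ f := by
  have hp : Prime (X 0 : MvPolynomial (Fin 4) k) := MvPolynomial.X_prime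
  rcases hp.dvd_or_dvd h with ⟨c, rfl⟩ | h
  · simp at hT
  · exact h

/-- `T₁, T₂` are coprime modulo `x`. -/
lemma coprime_mod_x {k : Type*} [Field k] (a : k) (c0 c1 h : MvPolynomial (Fin 4) k)
    (hh : (X 3 * (-(C a) * X 2 - X 3) - X 2 * (-X 1 - C a ^ 2 * X 2)) * c0
      - (X 3 * (X 1 - C a * X 3)) * c1 = X 0 * h) :
    ∃ e p q, c0 = (X 3 * (X 1 - C a * X 3)) * e + X 0 * p ∧
      c1 = (X 3 * (-(C a) * X 2 - X 3) - X 2 * (-X 1 - C a ^ 2 * X 2)) * e - X 0 * q := by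
  have hX : (X 0 : MvPolynomial (Fin 4) k) ≠ 0 := MvPolynomial.X_ne_zero 0
  have hp : Prime (X 0 : MvPolynomial (Fin 4) k) := MvPolynomial.X_prime
  set T := (X 3 * (-(C a) * X 2 - X 3) - X 2 * (-X 1 - C a ^ 2 * X 2) :
    MvPolynomial (Fin 4) k) with hTdef
  obtain ⟨p, c, h1⟩ := pair_prime (X 0) (X 3) ![0, X 1, X 2, 0]
    (by
      intro i
      fin_cases i
      · simpa using Ideal.subset_span (by simp)
      · simp
      · simp
      · simpa using Ideal.subset_span (by simp))
    (by simp) (by simp) T c0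
    (by
      have : aeval ![0, X 1, X 2, 0] T = (X 2 * (X 1 + C a ^ 2 * X 2) :
        MvPolynomial (Fin 4) k) := by
        simp [hTdef, algHom_C]; ring
      rw [this]
      refine mul_ne_zero (MvPolynomial.X_ne_zero _) ?_
      intro h0
      have := congrArg (eval ![0, 1, 0, 0]) h0
      simp at this)
    h ((X 1 - C a * X 3) * c1) (by linear_combination hh)
  -- cancel `w`
  have h2 : X 0 ∣ T * c - (X 1 - C a * X 3) * c1 := by
    apply prime_X0 (X 3) _ (by simp)
    exact ⟨h - T * p, by rw [h1] at hh; linear_combination hh⟩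
  obtain ⟨m, h2⟩ := h2
  obtain ⟨p', e, h3⟩ := pair_prime (X 0) (X 1 - C a * X 3) ![0, C a * X 3, X 2, X 3]
    (by
      intro i
      fin_cases i
      · simpa using Ideal.subset_span (by simp)
      · simpa using Ideal.subset_span (by simp)
      · simp
      · simp)
    (by simp) (by simp [algHom_C]) T c
    (by
      intro h0
      have := congrArg (eval ![0, 0, 0, 1]) h0
      simp [hTdef, algHom_C] at this)
    m c1 (by linear_combination h2)
  have h4 : X 0 ∣ T * e - c1 := by
    have : X 0 ∣ (X 1 - C a * X 3) * (T * e - c1) :=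
      ⟨m - T * p', by rw [h3] at h2; linear_combination h2⟩
    rcases hp.dvd_or_dvd this with ⟨r, hr⟩ | h
    · have := congrArg (eval ![0, 1, 0, 0]) hr
      simp at this
    · exact h
  obtain ⟨q, h4⟩ := h4
  exact ⟨e, p + X 3 * p', q, by rw [h1, h3]; ring, by linear_combination -h4⟩

/-- Syzygies of `z, w`. -/
lemma syz_zw {k : Type*} [Field k] (f g : MvPolynomial (Fin 4) k)
    (h : X 3 * f = X 2 * g) : ∃ t, f = X 2 * t ∧ g = X 3 * t := by
  have hp : Prime (X 2 : MvPolynomial (Fin 4) k) := MvPolynomial.X_prime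
  have : X 2 ∣ X 3 * f := ⟨g, h⟩
  rcases hp.dvd_or_dvd this with ⟨r, hr⟩ | ⟨t, rfl⟩
  · have := congrArg (eval ![0, 0, 0, 1]) hr
    simp at this
  · refine ⟨t, rfl, ?_⟩
    apply mul_left_cancel₀ (MvPolynomial.X_ne_zero (R := k) (2 : Fin 4))
    linear_combination -h

lemma exists_zw {k : Type*} [Field k] (c u v : MvPolynomial (Fin 4) k)
    (h : X 0 * c = u * X 2 + v * X 3) : ∃ r s, c = r * X 2 + s * X 3 :=
  pair_prime (X 2) (X 3) ![X 0, X 1, 0, 0]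
    (by
      intro i
      fin_cases i
      · simp
      · simp
      · simpa using Ideal.subset_span (by simp)
      · simpa using Ideal.subset_span (by simp))
    (by simp) (by simp) (X 0) c (by simp) u v h

/-- Proposition 5.3(a), case Ib: `J` is a grade three perfect ideal
and the explicit complex of format `(1,5,6,2)` is a graded minimal free resolution
of `Q/J`. -/
theorem stmt_11 (k : Type*) [Field k] (a : k) :
    let Q := MvPolynomial (Fin 4) k
    let x : Q := X 0
    let y : Q := X 1
    let z : Q := X 2
    let w : Q := X 3
    let A := y - C a * w
    let B : Q := 0
    let Cc := - (C a) * z - w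
    let D := - y - C a ^ 2 * z
    let T₁ := w * Cc - z * D
    let T₂ := w * A - z * B
    let T₅ := B * Cc - A * D
    let J : Ideal Q := Ideal.span {x ^ 2, x * z, x * w, T₁, T₂}
    let M1 : Matrix (Fin 1) (Fin 5) Q := !![T₁, -T₂, -(x * w), x * z, -(x ^ 2)]
    let M2 : Matrix (Fin 5) (Fin 6) Q :=
      !![T₂, 0, x, 0, 0, 0;
         T₁, -x, 0, 0, 0, 0;
         0, A, Cc, 0, -x, -z;
         0, B, D, x, 0, -w;
         0, 0, 0, z, w, 0]
    let M3 : Matrix (Fin 6) (Fin 2) Q :=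
      !![x, 0;
         T₁, 0;
         -T₂, 0;
         0, -w;
         0, z;
         T₅, -x]
    let d1 : (Fin 5 → Q) →ₗ[Q] Q :=
      (LinearEquiv.funUnique (Fin 1) Q Q).toLinearMap ∘ₗ Matrix.toLin' M1
    let d2 : (Fin 6 → Q) →ₗ[Q] (Fin 5 → Q) := Matrix.toLin' M2
    let d3 : (Fin 2 → Q) →ₗ[Q] (Fin 6 → Q) := Matrix.toLin' M3
    -- `J` contains a regular sequence of length three (so `grade J = 3`), and the
    -- length-three free resolution below shows that `J` is perfect of grade three
    (RingTheory.Sequence.IsRegular Q [x ^ 2, T₁, T₂] ∧ ∀ r ∈ [x ^ 2, T₁, T₂], r ∈ J) ∧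
    -- the complex `0 → Q² → Q⁶ → Q⁵ → Q` is exact and resolves `Q/J`
    Function.Injective d3 ∧
    LinearMap.range d3 = LinearMap.ker d2 ∧
    LinearMap.range d2 = LinearMap.ker d1 ∧
    LinearMap.range d1 = J ∧
    -- the resolution is graded, with twists `0 → Q(−5)⊕Q(−4) → Q(−4)⊕Q⁵(−3) → Q⁵(−2) → Q`
    (∀ j, (M1 0 j).IsHomogeneous 2) ∧
    (∀ i, (M2 i 0).IsHomogeneous 2) ∧
    (∀ i j, j ≠ 0 → (M2 i j).IsHomogeneous 1) ∧
    ((M3 0 0).IsHomogeneous 1) ∧ (∀ i, i ≠ 0 → (M3 i 0).IsHomogeneous 2) ∧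
    (M3 0 1 = 0) ∧ (∀ i, i ≠ 0 → (M3 i 1).IsHomogeneous 1) := by
  intro Q x y z w A B Cc D T₁ T₂ T₅ J M1 M2 M3 d1 d2 d3
  have hx0 : x ≠ 0 := MvPolynomial.X_ne_zero 0
  have hz0 : z ≠ 0 := MvPolynomial.X_ne_zero 2
  have hw0 : w ≠ 0 := MvPolynomial.X_ne_zero 3
  have hT2 : T₂ = w * A := by simp [T₂, B]
  have hT1e : eval ![0, 0, 0, 1] T₁ ≠ 0 := by
    simp [T₁, Cc, D, y, z, w]
  have cop : ∀ c0 c1 h : Q, T₁ * c0 - T₂ * c1 = x * h →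
      ∃ e p q, c0 = T₂ * e + x * p ∧ c1 = T₁ * e - x * q := by
    rw [hT2]
    exact fun c0 c1 h => coprime_mod_x a c0 c1 h
  have pr : ∀ f : Q, x ∣ T₁ * f → x ∣ f := fun f => prime_X0 T₁ f hT1e
  have d1v : ∀ c, d1 c = T₁ * c 0 - T₂ * c 1 - x * w * c 2 + x * z * c 3 - x ^ 2 * c 4 := by
    intro c
    simp [d1, M1, Matrix.mulVec, dotProduct, Fin.sum_univ_succ]
    ring
  have d2v : ∀ v, d2 v = ![T₂ * v 0 + x * v 2, T₁ * v 0 - x * v 1,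
      A * v 1 + Cc * v 2 - x * v 4 - z * v 5, B * v 1 + D * v 2 + x * v 3 - w * v 5,
      z * v 3 + w * v 4] := by
    intro v
    ext1 i
    fin_cases i <;> simp [d2, M2, Matrix.mulVec, dotProduct, Fin.sum_univ_succ] <;> ring
  have d3v : ∀ v, d3 v = ![x * v 0, T₁ * v 0, -T₂ * v 0, -w * v 1, z * v 1,
      T₅ * v 0 - x * v 1] := by
    intro v
    ext1 i
    fin_cases i <;> simp [d3, M3, Matrix.mulVec, dotProduct, Fin.sum_univ_succ] <;> ring
  have hxJ : x ^ 2 ∈ J := Ideal.subset_span (by simp)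
  have hxzJ : x * z ∈ J := Ideal.subset_span (by simp)
  have hxwJ : x * w ∈ J := Ideal.subset_span (by simp)
  have h1J : T₁ ∈ J := Ideal.subset_span (by simp)
  have h2J : T₂ ∈ J := Ideal.subset_span (by simp)
  have hX : ∀ i : Fin 4, (X i : Q).IsHomogeneous 1 := fun i => isHomogeneous_X k i
  have hCX : ∀ (c : k) (i : Fin 4), (C c * X i : Q).IsHomogeneous 1 := fun c i => by
    simpa using (isHomogeneous_C (Fin 4) c).mul (hX i)
  have z1 : (0 : Q).IsHomogeneous 1 := isHomogeneous_zero _ _ _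
  have z2 : (0 : Q).IsHomogeneous 2 := isHomogeneous_zero _ _ _
  have hx : x.IsHomogeneous 1 := hX 0
  have hz : z.IsHomogeneous 1 := hX 2
  have hw : w.IsHomogeneous 1 := hX 3
  have hA : A.IsHomogeneous 1 := (hX 1).sub (hCX a 3)
  have hB : B.IsHomogeneous 1 := z1
  have hC : Cc.IsHomogeneous 1 := by
    have := (hCX (-a) 2).sub (hX 3)
    simpa [Cc, z, w] using this
  have hD : D.IsHomogeneous 1 := by
    have := (hX 1).neg.sub (hCX (a ^ 2) 2)
    simpa [D, z, y] using this
  have hT1 : T₁.IsHomogeneous 2 := (hw.mul hC).sub (hz.mul hD)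
  have hT2h : T₂.IsHomogeneous 2 := (hw.mul hA).sub (hz.mul hB)
  have hT5 : T₅.IsHomogeneous 2 := (hB.mul hC).sub (hA.mul hD)
  have hT5' : T₅ = - (A * D) := by simp [T₅, B]
  refine ⟨⟨⟨⟨?_⟩, ?_⟩, ?_⟩, ?_, ?_, ?_, ?_, ?_, ?_, ?_, ?_, ?_, ?_, ?_⟩
  · -- weakly regular
    intro i hi
    rw [isSMulRegular_quotient_iff_mem_of_smul_mem]
    intro f hf
    simp only [smul_eq_mul, Ideal.mul_top] at hf ⊢
    have hi' : i < 3 := hi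
    interval_cases i
    · simp [Ideal.ofList] at hf ⊢
      exact hf.resolve_left hx0
    · simp [Ideal.ofList, Ideal.mem_span_singleton] at hf ⊢
      obtain ⟨g, hg⟩ := hf
      obtain ⟨f', rfl⟩ := pr f ⟨x * g, by linear_combination hg⟩
      obtain ⟨f'', rfl⟩ := pr f' ⟨g, by
        apply mul_left_cancel₀ hx0
        linear_combination hg⟩
      exact ⟨f'', by ring⟩
    · have e : Ideal.ofList (List.take 2 [x ^ 2, T₁, T₂]) = Ideal.span {x ^ 2, T₁} := by
        simp [Ideal.ofList_cons, Ideal.span_insert]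
      rw [e, Ideal.mem_span_pair] at hf ⊢
      obtain ⟨h, g, hg⟩ := hf
      simp only [List.getElem_cons_succ, List.getElem_cons_zero] at hg
      obtain ⟨e, p, q, h1, h2⟩ := cop g f (-(x * h)) (by linear_combination hg)
      obtain ⟨e', p', q', h3, h4⟩ := cop p (-q) (-h) (by
        apply mul_left_cancel₀ hx0
        rw [h1, h2] at hg
        linear_combination hg)
      exact ⟨-q', e + x * e', by rw [h2]; linear_combination -x * h4⟩
  · -- proper
    intro htop
    have ex : eval (![0, 0, 0, 0] : Fin 4 → k) x = 0 := by simp [x]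
    have ez : eval (![0, 0, 0, 0] : Fin 4 → k) z = 0 := by simp [z]
    have ew : eval (![0, 0, 0, 0] : Fin 4 → k) w = 0 := by simp [w]
    have hle : Ideal.ofList [x ^ 2, T₁, T₂] ≤ RingHom.ker (eval (![0, 0, 0, 0] : Fin 4 → k)) := by
      rw [Ideal.ofList, Ideal.span_le]
      intro r hr
      simp at hr
      rcases hr with rfl | rfl | rfl <;>
        simp [RingHom.mem_ker, T₁, T₂, ex, ez, ew]
    rw [smul_eq_mul, Ideal.mul_top] at htop
    rw [← htop] at hle
    have := hle (Submodule.mem_top (x := (1 : Q)))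
    simp [RingHom.mem_ker] at this
  · intro r hr
    simp at hr
    rcases hr with rfl | rfl | rfl <;> assumption
  · -- injective
    rw [injective_iff_map_eq_zero]
    intro v hv
    rw [d3v] at hv
    have e0 := congrFun hv 0
    have e4 := congrFun hv 4
    simp at e0 e4
    ext1 i
    fin_cases i
    · exact e0.resolve_left hx0
    · exact e4.resolve_left hz0
  · apply le_antisymm
    · rintro _ ⟨v, rfl⟩
      rw [LinearMap.mem_ker, d2v, d3v]
      ext1 i
      fin_cases i <;> simp [hT2, hT5', T₁, B] <;> ring
    · intro v hv
      rw [LinearMap.mem_ker, d2v] at hv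
      have e0 := congrFun hv 0
      have e1 := congrFun hv 1
      have e2 := congrFun hv 2
      have e4 := congrFun hv 4
      simp at e0 e1 e2 e4
      obtain ⟨u, hu⟩ := pr (v 0) ⟨v 1, by linear_combination e1⟩
      have h1 : v 1 = T₁ * u := by
        apply mul_left_cancel₀ hx0
        rw [hu] at e1
        linear_combination -e1
      have h2 : v 2 = -T₂ * u := by
        apply mul_left_cancel₀ hx0
        rw [hu] at e0
        linear_combination e0
      obtain ⟨t, h4, h3⟩ := syz_zw (v 4) (-v 3) (by
        change w * v 4 = z * -v 3
        linear_combination e4)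
      have h5 : v 5 = T₅ * u - x * t := by
        apply mul_left_cancel₀ hz0
        rw [h1, h2, h4, hT2] at e2
        rw [hT5']
        simp only [T₁] at e2
        linear_combination -e2
      refine ⟨![u, t], ?_⟩
      rw [d3v]
      ext1 i
      fin_cases i
      · simpa using hu.symm
      · simpa using h1.symm
      · simpa using h2.symm
      · have : v 3 = -(w * t) := by rw [← neg_neg (v 3), h3]
        exact (this.trans (neg_mul w t).symm).symm
      · simpa using h4.symm
      · simpa using h5.symm
  · apply le_antisymm
    · rintro _ ⟨v, rfl⟩
      rw [LinearMap.mem_ker, d1v, d2v]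
      simp [hT2, T₁, B]
      ring
    · intro c hc
      rw [LinearMap.mem_ker, d1v] at hc
      obtain ⟨e, p, q, h0, h1⟩ := cop (c 0) (c 1) (w * c 2 - z * c 3 + x * c 4)
        (by linear_combination hc)
      have hc' : w * (Cc * p + A * q - c 2) - z * (D * p + B * q - c 3) = x * c 4 := by
        apply mul_left_cancel₀ hx0
        rw [h0, h1] at hc
        simp only [T₁, T₂] at hc
        linear_combination hc
      obtain ⟨r, s, h4⟩ := exists_zw (c 4) (-(D * p + B * q - c 3)) (Cc * p + A * q - c 2)
        (by
          change x * c 4 = _ * z + _ * w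
          linear_combination -hc')
      change c 4 = r * z + s * w at h4
      obtain ⟨t, h2, h3⟩ := syz_zw (Cc * p + A * q - c 2 - x * s)
        (D * p + B * q - c 3 + x * r) (by
          change w * _ = z * _
          rw [h4] at hc'
          linear_combination hc')
      change _ = z * t at h2
      change _ = w * t at h3
      refine ⟨![e, q, p, r, s, t], ?_⟩
      rw [d2v]
      ext1 i
      fin_cases i
      · simpa using h0.symm
      · simpa using h1.symm
      · change A * q + Cc * p - x * s - z * t = c 2
        linear_combination h2
      · change B * q + D * p + x * r - w * t = c 3
        linear_combination h3
      · change z * r + w * s = c 4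
        linear_combination -h4
  · apply le_antisymm
    · rintro _ ⟨c, rfl⟩
      rw [d1v]
      refine J.sub_mem (J.add_mem (J.sub_mem (J.sub_mem ?_ ?_) ?_) ?_) ?_ <;>
        exact J.mul_mem_right _ (by assumption)
    · apply Ideal.span_le.2
      intro r hr
      simp only [Set.mem_insert_iff, Set.mem_singleton_iff] at hr
      rcases hr with rfl | rfl | rfl | rfl | rfl
      · exact ⟨![0, 0, 0, 0, -1], by rw [d1v]; simp; ring⟩
      · exact ⟨![0, 0, 0, 1, 0], by rw [d1v]; simp⟩
      · exact ⟨![0, 0, -1, 0, 0], by rw [d1v]; simp; ring⟩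
      · exact ⟨![1, 0, 0, 0, 0], by rw [d1v]; simp⟩
      · exact ⟨![0, -1, 0, 0, 0], by rw [d1v]; simp; ring⟩
  · intro j
    fin_cases j
    · exact hT1
    · exact hT2h.neg
    · exact (hx.mul hw).neg
    · exact hx.mul hz
    · exact (hx.pow 2).neg
  · intro i
    fin_cases i
    · exact hT2h
    · exact hT1
    all_goals exact z2
  · intro i j hj
    fin_cases i <;> fin_cases j <;> first
      | exact absurd rfl hj
      | exact z1
      | exact hx
      | exact hx.neg
      | exact hA
      | exact hC
      | exact hD
      | exact hz
      | exact hz.neg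
      | exact hw
      | exact hw.neg
  · exact hx
  · intro i hi
    fin_cases i
    · exact absurd rfl hi
    · exact hT1
    · exact hT2h.neg
    · exact z2
    · exact z2
    · exact hT5
  · rfl
  · intro i hi
    fin_cases i
    · exact absurd rfl hi
    · exact z1
    · exact z1
    · exact hw.neg
    · exact hz
    · exact hx.neg
end

section
/- Let k be a field and Q = k[x,y,z,w]. For the ideal J = (xy, xz, xw, y², yz−w²) and the quadric q = yw + z², the colon ideal satisfies J : (q) = J + (x). -/
open MvPolynomial

/-- Every polynomial has a normal form over `k[z]` with basis `1, y, w, yw` modulo `J + (x)`. -/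
lemma normal_form_aux (k : Type*) [Field k] (I : Ideal (MvPolynomial (Fin 4) k))
    (hx : (X 0 : MvPolynomial (Fin 4) k) ∈ I) (hy : (X 1 ^ 2 : MvPolynomial (Fin 4) k) ∈ I)
    (hw : (X 1 * X 2 - X 3 ^ 2 : MvPolynomial (Fin 4) k) ∈ I) (f : MvPolynomial (Fin 4) k) :
    ∃ a b c d : Polynomial k, f - (Polynomial.aeval (X 2) a + Polynomial.aeval (X 2) b * X 1
      + Polynomial.aeval (X 2) c * X 3 + Polynomial.aeval (X 2) d * (X 1 * X 3)) ∈ I := by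
  induction f using MvPolynomial.induction_on with
  | C r =>
    refine ⟨Polynomial.C r, 0, 0, 0, ?_⟩
    simp [MvPolynomial.algebraMap_eq]
  | add p q hp hq =>
    obtain ⟨a, b, c, d, h⟩ := hp
    obtain ⟨a', b', c', d', h'⟩ := hq
    refine ⟨a + a', b + b', c + c', d + d', ?_⟩
    convert I.add_mem h h' using 1
    simp only [map_add]
    ring
  | mul_X p i hp =>
    obtain ⟨a, b, c, d, h⟩ := hp
    have hi := I.mul_mem_right (X i) h
    fin_cases i
    · refine ⟨0, 0, 0, 0, ?_⟩
      simpa using I.mul_mem_left p hx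
    · refine ⟨0, a, 0, c, ?_⟩
      convert I.add_mem hi (I.mul_mem_left (Polynomial.aeval (X 2) b
        + Polynomial.aeval (X 2) d * X 3) hy) using 1
      simp only [map_zero, Fin.mk_one]
      ring
    · refine ⟨a * Polynomial.X, b * Polynomial.X, c * Polynomial.X, d * Polynomial.X, ?_⟩
      convert hi using 1
      simp only [map_mul, Polynomial.aeval_X, Fin.reduceFinMk]
      ring
    · refine ⟨0, c * Polynomial.X, a, b, ?_⟩
      convert I.add_mem hi (I.add_mem (I.mul_mem_left (-(Polynomial.aeval (X 2) c
        + Polynomial.aeval (X 2) d * X 1)) hw)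
        (I.mul_mem_left (Polynomial.aeval (X 2) d * X 2) hy)) using 1
      simp only [map_zero, map_mul, Polynomial.aeval_X, Fin.reduceFinMk]
      ring

/-- The map `x ↦ 0, y ↦ s², z ↦ t², w ↦ s t` into `k[t][s]`. -/
noncomputable def phiAux (k : Type*) [Field k] :
    MvPolynomial (Fin 4) k →ₐ[k] Polynomial (Polynomial k) :=
  aeval ![0, Polynomial.X ^ 2, Polynomial.C (Polynomial.X ^ 2),
    Polynomial.X * Polynomial.C Polynomial.X]

lemma phiAux_aeval (k : Type*) [Field k] (a : Polynomial k) :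
    phiAux k (Polynomial.aeval (X 2) a) = Polynomial.C (Polynomial.expand k 2 a) := by
  induction a using Polynomial.induction_on' with
  | add p q hp hq => simp only [map_add, hp, hq]
  | monomial n r =>
    rw [← Polynomial.C_mul_X_pow_eq_monomial]
    simp [phiAux, Polynomial.algebraMap_apply]

lemma phiAux_I (k : Type*) [Field k] (f : MvPolynomial (Fin 4) k)
    (hf : f ∈ Ideal.span {(X 0 : MvPolynomial (Fin 4) k), X 1 ^ 2, X 1 * X 2 - X 3 ^ 2}) :
    Polynomial.X ^ 4 ∣ phiAux k f := by
  rw [← Ideal.mem_span_singleton, ← Ideal.mem_comap]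
  refine Ideal.span_le.2 ?_ hf
  rintro g (rfl | rfl | rfl)
  · simp [phiAux]
  · simp [phiAux, Ideal.mem_span_singleton, ← pow_mul]
  · simp [phiAux, Ideal.mem_span_singleton, mul_pow]
    exact Dvd.intro 0 (by ring)

/-- case IIb, node singularity: `J : (yw + z²) = J + (x)`. -/
theorem stmt_12 (k : Type*) [Field k] :
    let x : MvPolynomial (Fin 4) k := X 0
    let y : MvPolynomial (Fin 4) k := X 1
    let z : MvPolynomial (Fin 4) k := X 2
    let w : MvPolynomial (Fin 4) k := X 3
    let J : Ideal (MvPolynomial (Fin 4) k) :=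
      Ideal.span {x * y, x * z, x * w, y ^ 2, y * z - w ^ 2}
    let q := y * w + z ^ 2
    J.colon (Ideal.span {q}) = J ⊔ Ideal.span {x} := by
  intro x y z w J q
  have m1 : x * y ∈ J := Ideal.subset_span (by simp)
  have m2 : x * z ∈ J := Ideal.subset_span (by simp)
  have m4 : y ^ 2 ∈ J := Ideal.subset_span (by simp)
  have m5 : y * z - w ^ 2 ∈ J := Ideal.subset_span (by simp)
  have hxI : x ∈ J ⊔ Ideal.span {x} := Ideal.mem_sup_right (Ideal.mem_span_singleton_self x)
  apply le_antisymm
  · intro f hf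
    rw [Ideal.mem_colon_span_singleton] at hf
    have hJ : J ≤ Ideal.span {x, y ^ 2, y * z - w ^ 2} := by
      have h0 : x ∈ Ideal.span {x, y ^ 2, y * z - w ^ 2} := Ideal.subset_span (by simp)
      refine Ideal.span_le.2 ?_
      rintro g (rfl | rfl | rfl | rfl | rfl)
      · exact Ideal.mul_mem_right _ _ h0
      · exact Ideal.mul_mem_right _ _ h0
      · exact Ideal.mul_mem_right _ _ h0
      · exact Ideal.subset_span (by simp)
      · exact Ideal.subset_span (by simp)
    have h1 := phiAux_I k _ (hJ hf)
    rw [map_mul] at h1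
    have h2 : Polynomial.X ^ 4 ∣ phiAux k f := by
      refine Polynomial.prime_X.pow_dvd_of_dvd_mul_right 4 ?_ h1
      rw [Polynomial.X_dvd_iff]
      simp [phiAux, q, y, z, w, Polynomial.coeff_zero_eq_eval_zero]
    obtain ⟨a, b, c, d, h⟩ := normal_form_aux k (Ideal.span {x, y ^ 2, y * z - w ^ 2})
      (Ideal.subset_span (by simp [x])) (Ideal.subset_span (by simp [y]))
      (Ideal.subset_span (by simp [y, z, w])) f
    have h3 := (dvd_sub_right h2).1 (by simpa only [map_sub] using phiAux_I k _ h)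
    have e1 : phiAux k (X 1) = Polynomial.X ^ 2 := by simp [phiAux]
    have e3 : phiAux k (X 3) = Polynomial.X * Polynomial.C Polynomial.X := by simp [phiAux]
    simp only [map_add, map_mul, phiAux_aeval, e1, e3] at h3
    have h4 : Polynomial.X ^ 4 ∣ Polynomial.C (Polynomial.expand k 2 a)
        + Polynomial.C (Polynomial.expand k 2 b) * Polynomial.X ^ 2
        + Polynomial.C (Polynomial.expand k 2 c * Polynomial.X) * Polynomial.X ^ 1
        + Polynomial.C (Polynomial.expand k 2 d * Polynomial.X) * Polynomial.X ^ 3 := by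
      convert h3 using 1
      simp only [map_mul]
      ring
    rw [Polynomial.X_pow_dvd_iff] at h4
    have c0 := h4 0 (by norm_num)
    have c1 := h4 1 (by norm_num)
    have c2 := h4 2 (by norm_num)
    have c3 := h4 3 (by norm_num)
    simp only [Polynomial.coeff_add, Polynomial.coeff_C_mul, Polynomial.coeff_X_pow,
      Polynomial.coeff_C] at c0 c1 c2 c3
    norm_num [Polynomial.expand_eq_zero] at c0 c1 c2 c3
    subst c0 c1 c2 c3
    simp only [map_zero, zero_mul, add_zero, sub_zero] at h
    refine Ideal.span_le.2 ?_ h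
    rintro g (rfl | rfl | rfl)
    · exact hxI
    · exact Ideal.mem_sup_left m4
    · exact Ideal.mem_sup_left m5
  · refine sup_le ?_ ?_
    · intro f hf
      rw [Ideal.mem_colon_span_singleton]
      exact J.mul_mem_right _ hf
    · rw [Ideal.span_singleton_le_iff_mem, Ideal.mem_colon_span_singleton]
      convert J.add_mem (J.mul_mem_right w m1) (J.mul_mem_right z m2) using 1
      simp only [q]
      ring
end

section
/- Let k be a field and Q = k[x,y,z,w]. The ideal J = (x², xz, xw, yz, yw, z²) equals the ideal of 2×2 minors of the 2×4 matrix M = [[x, y, 0, z],[0, x, z, w]], J is a grade three perfect ideal, and the Eagon–Northcott complex of M gives a graded minimal free resolution of Q/J of format (1,6,8,3): 0 → Q³(−4) → Q⁸(−3) → Q⁶(−2) → Q. -/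
open MvPolynomial

section Helpers

variable {k : Type*} [Field k]

lemma mem_span_pow_iff (n : ℕ) (a : MvPolynomial (Fin 4) k) :
    a ∈ Ideal.span {(X 0 : MvPolynomial (Fin 4) k) ^ n, X 2 ^ n} ↔
      ∀ m ∈ a.support, n ≤ m 0 ∨ n ≤ m 2 := by
  have h : ({(X 0 : MvPolynomial (Fin 4) k) ^ n, X 2 ^ n} : Set (MvPolynomial (Fin 4) k)) =
      (fun s => monomial s (1 : k)) '' {Finsupp.single 0 n, Finsupp.single 2 n} := by
    simp [Set.image_pair, X_pow_eq_monomial]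
  rw [h, mem_ideal_span_monomial_image]
  simp [Finsupp.single_le_iff]

lemma mem_of_X_mul_mem (n : ℕ) (j : Fin 4) (h0 : j ≠ 0) (h2 : j ≠ 2)
    (a : MvPolynomial (Fin 4) k)
    (h : X j * a ∈ Ideal.span {(X 0 : MvPolynomial (Fin 4) k) ^ n, X 2 ^ n}) :
    a ∈ Ideal.span {(X 0 : MvPolynomial (Fin 4) k) ^ n, X 2 ^ n} := by
  rw [mem_span_pow_iff] at h ⊢
  intro m hm
  have := h (Finsupp.single j 1 + m) (by
    rw [mem_support_iff] at hm ⊢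
    rwa [coeff_X_mul])
  simpa [Finsupp.single_apply, h0, h2] using this

lemma exists_of_X_mul (j : Fin 4) (h0 : j ≠ 0) (h2 : j ≠ 2)
    (a p q : MvPolynomial (Fin 4) k) (h : X j * a = X 0 * p + X 2 * q) :
    ∃ p' q', a = X 0 * p' + X 2 * q' := by
  have := mem_of_X_mul_mem 1 j h0 h2 a (by
    rw [Ideal.mem_span_pair]
    exact ⟨p, q, by rw [h]; ring⟩)
  rw [Ideal.mem_span_pair] at this
  obtain ⟨p', q', e⟩ := this
  exact ⟨p', q', by rw [← e]; ring⟩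

lemma X_dvd_of_X_dvd_mul (i j : Fin 4) (hij : i ≠ j) (a : MvPolynomial (Fin 4) k)
    (h : (X i : MvPolynomial (Fin 4) k) ∣ X j * a) : (X i : MvPolynomial (Fin 4) k) ∣ a := by
  rcases (X_prime (R := k) (i := i)).dvd_or_dvd h with h | h
  · exact absurd (X_dvd_X.1 h) (by tauto)
  · exact h

lemma EN_exact2 (x y z w : MvPolynomial (Fin 4) k) (hx : x = X 0) (hy : y = X 1)
    (hz : z = X 2) (hw : w = X 3) (v1 v2 v3 v4 v5 v6 v7 v8 : MvPolynomial (Fin 4) k)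
    (e1 : - z * v2 - z * v3 - w * v4 = 0)
    (e3 : - x * v1 - z * v7 - w * v8 = 0)
    (e4 : y * v3 + x * v4 + z * v6 = 0)
    (e5 : - x * v3 + z * v8 = 0)
    (e6 : - x * v5 - y * v7 - x * v8 = 0) :
    ∃ c1 c2 c3, v1 = z * c1 + w * c2 ∧ v2 = z * c2 + w * c3 ∧ v3 = - z * c2 ∧
      v4 = - z * c3 ∧ v5 = y * c1 + x * c2 ∧ v6 = y * c2 + x * c3 ∧ v7 = - x * c1 ∧
      v8 = - x * c2 := by
  have hx0 : x ≠ 0 := hx ▸ X_ne_zero 0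
  have hz0 : z ≠ 0 := hz ▸ X_ne_zero 2
  obtain ⟨c2, h8⟩ : x ∣ v8 := by
    subst hx hz
    exact X_dvd_of_X_dvd_mul 0 2 (by decide) _ ⟨v3, by linear_combination e5⟩
  obtain ⟨c1, h7⟩ : x ∣ v7 := by
    subst hx hy
    exact X_dvd_of_X_dvd_mul 0 1 (by decide) _ ⟨-v5 - v8, by linear_combination -e6⟩
  obtain ⟨c3, h4⟩ : z ∣ v4 := by
    subst hz hw
    exact X_dvd_of_X_dvd_mul 2 3 (by decide) _ ⟨-v2 - v3, by linear_combination -e1⟩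
  subst h8 h7 h4
  have h3 : v3 = z * c2 := mul_left_cancel₀ hx0 (by linear_combination -e5)
  subst h3
  refine ⟨-c1, -c2, -c3, ?_, ?_, by ring, by ring, ?_, ?_, by ring, by ring⟩
  · exact mul_left_cancel₀ hx0 (by linear_combination -e3)
  · exact mul_left_cancel₀ hz0 (by linear_combination -e1)
  · exact mul_left_cancel₀ hx0 (by linear_combination -e6)
  · exact mul_left_cancel₀ hz0 (by linear_combination e4)

lemma EN_exact1 (x y z w : MvPolynomial (Fin 4) k) (hx : x = X 0) (hy : y = X 1)
    (hz : z = X 2) (hw : w = X 3) (a1 a2 a3 a4 a5 a6 : MvPolynomial (Fin 4) k)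
    (e : x ^ 2 * a1 + x * z * a2 + y * z * a3 + x * w * a4 + (w * y - x * z) * a5
      - z ^ 2 * a6 = 0) :
    ∃ v1 v2 v3 v4 v5 v6 v7 v8, a1 = - z * v2 - z * v3 - w * v4 ∧
      a2 = y * v1 + x * v2 - z * v5 - w * v6 ∧ a3 = - x * v1 - z * v7 - w * v8 ∧
      a4 = y * v3 + x * v4 + z * v6 ∧ a5 = - x * v3 + z * v8 ∧
      a6 = - x * v5 - y * v7 - x * v8 := by
  have hx0 : x ≠ 0 := hx ▸ X_ne_zero 0
  have hz0 : z ≠ 0 := hz ▸ X_ne_zero 2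
  have ky : ∀ a p q, y * a = x * p + z * q → ∃ p' q', a = x * p' + z * q' := by
    subst hx hy hz
    exact exists_of_X_mul 1 (by decide) (by decide)
  have kw : ∀ a p q, w * a = x * p + z * q → ∃ p' q', a = x * p' + z * q' := by
    subst hx hw hz
    exact exists_of_X_mul 3 (by decide) (by decide)
  obtain ⟨p, q, h⟩ := kw (y * a5) (-x * a1 - z * a2 - w * a4 + z * a5) (-y * a3 + z * a6)
    (by linear_combination e)
  obtain ⟨v3', v8, h5⟩ := ky _ _ _ h
  obtain ⟨v3, rfl⟩ : ∃ t, v3' = -t := ⟨-v3', by ring⟩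
  subst h5
  -- remove a5
  obtain ⟨b1, hb1⟩ : ∃ t, t = a1 + z * v3 := ⟨_, rfl⟩
  obtain ⟨b3, hb3⟩ : ∃ t, t = a3 + w * v8 := ⟨_, rfl⟩
  obtain ⟨b4, hb4⟩ : ∃ t, t = a4 - y * v3 := ⟨_, rfl⟩
  obtain ⟨b6, hb6⟩ : ∃ t, t = a6 + x * v8 := ⟨_, rfl⟩
  have e' : x ^ 2 * b1 + x * z * a2 + y * z * b3 + x * w * b4 - z ^ 2 * b6 = 0 := by
    subst hb1 hb3 hb4 hb6
    linear_combination e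
  obtain ⟨r, hr⟩ : x ∣ y * b3 - z * b6 := by
    subst hx hz
    exact X_dvd_of_X_dvd_mul 0 2 (by decide) _ ⟨-(X 0 * b1 + X 2 * a2 + w * b4), by
      linear_combination e'⟩
  obtain ⟨v1', v7', h3⟩ := ky b3 r b6 (by linear_combination hr)
  obtain ⟨s, hs⟩ : x ∣ b6 - y * v7' := by
    subst hx hz
    refine X_dvd_of_X_dvd_mul 0 2 (by decide) _ ⟨y * v1' - r, ?_⟩
    rw [h3] at hr
    linear_combination -hr
  have e2 : x * b1 + z * (a2 + y * v1' - z * s) + w * b4 = 0 := by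
    apply mul_left_cancel₀ hx0
    rw [h3] at e'
    linear_combination e' + z ^ 2 * hs
  obtain ⟨v4, v6, h4⟩ := kw b4 (-b1) (-(a2 + y * v1' - z * s)) (by linear_combination e2)
  subst h4
  obtain ⟨t, ht⟩ : z ∣ b1 + w * v4 := by
    subst hx hz
    exact X_dvd_of_X_dvd_mul 2 0 (by decide) _ ⟨-(a2 + y * v1' - X 2 * s + w * v6), by
      linear_combination e2⟩
  have h2 : a2 + y * v1' - z * s + w * v6 = - x * t := by
    apply mul_left_cancel₀ hz0
    linear_combination e2 - x * ht
  refine ⟨-v1', -t, v3, v4, -s, v6, -v7', v8, ?_, ?_, ?_, ?_, ?_, ?_⟩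
  · linear_combination ht - hb1
  · linear_combination h2
  · linear_combination h3 - hb3
  · linear_combination -hb4
  · ring
  · linear_combination hs - hb6

lemma regular_seq : RingTheory.Sequence.IsRegular (MvPolynomial (Fin 4) k)
    [(X 0 : MvPolynomial (Fin 4) k) ^ 2, X 2 ^ 2, X 1 * X 3] := by
  refine ⟨?_, ?_⟩
  · rw [RingTheory.Sequence.isWeaklyRegular_iff]
    intro i hi
    rw [isSMulRegular_quotient_iff_mem_of_smul_mem]
    intro a ha
    simp only [List.length_cons, List.length_nil] at hi
    interval_cases i
    · simp at ha ⊢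
      exact ha
    · simp [Ideal.mem_span_singleton] at ha ⊢
      have hp : IsRelPrime ((X 0 : MvPolynomial (Fin 4) k) ^ 2) (X 2 ^ 2) := by
        apply IsRelPrime.pow
        rw [(X_prime (R := k) (i := (0 : Fin 4))).irreducible.isRelPrime_iff_not_dvd]
        exact fun h => absurd (X_dvd_X.1 h) (by simp)
      exact hp.dvd_of_dvd_mul_left ha
    · have e : Ideal.ofList (List.take 2
          [(X 0 : MvPolynomial (Fin 4) k) ^ 2, X 2 ^ 2, X 1 * X 3]) =
          Ideal.span {X 0 ^ 2, X 2 ^ 2} := by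
        simp [Ideal.ofList, Set.insert_def]
      rw [e] at ha ⊢
      simp only [smul_eq_mul, Ideal.mul_top] at ha ⊢
      exact mem_of_X_mul_mem 2 3 (by decide) (by decide) _
        (mem_of_X_mul_mem 2 1 (by decide) (by decide) _ (by simpa [mul_assoc] using ha))
  · intro h
    have h1 : (1 : MvPolynomial (Fin 4) k) ∈ Ideal.ofList
        [(X 0 : MvPolynomial (Fin 4) k) ^ 2, X 2 ^ 2, X 1 * X 3] := by
      have : (1 : MvPolynomial (Fin 4) k) ∈ (⊤ : Submodule (MvPolynomial (Fin 4) k) _) := trivial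
      rw [h] at this
      simpa using this
    have h2 : Ideal.ofList [(X 0 : MvPolynomial (Fin 4) k) ^ 2, X 2 ^ 2, X 1 * X 3] ≤
        RingHom.ker (constantCoeff (R := k) (σ := Fin 4)) := by
      rw [Ideal.ofList, Ideal.span_le]
      intro r hr
      simp at hr
      rcases hr with rfl | rfl | rfl <;> simp
    simpa using h2 h1

end Helpers

/-- Proposition 7.2(a), case IIId: `J = (x², xz, xw, yz, yw, z²)` is the
ideal of 2×2 minors of the matrix `M = [[x,y,0,z],[0,x,z,w]]`, it is a grade three
perfect ideal, and the Eagon–Northcott complex of `M` is a graded minimal free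
resolution of `Q/J` of format `(1,6,8,3)`. -/
theorem stmt_19 (k : Type*) [Field k] :
    let Q := MvPolynomial (Fin 4) k
    let x : Q := X 0
    let y : Q := X 1
    let z : Q := X 2
    let w : Q := X 3
    let A := y
    let B : Q := 0
    let Cc := z
    let J : Ideal Q := Ideal.span {x ^ 2, x * z, x * w, y * z, y * w, z ^ 2}
    let M : Matrix (Fin 2) (Fin 4) Q := !![x, A, B, Cc; 0, x, z, w]
    -- the Eagon–Northcott complex of `M`
    let M1 : Matrix (Fin 1) (Fin 6) Q :=
      !![x ^ 2, x * z, z * A - x * B, x * w, w * A - x * Cc, w * B - z * Cc]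
    let M2 : Matrix (Fin 6) (Fin 8) Q :=
      !![-B, -z, -Cc, -w, 0, 0, 0, 0;
         A, x, 0, 0, -Cc, -w, 0, 0;
         -x, 0, 0, 0, 0, 0, -Cc, -w;
         0, 0, A, x, B, z, 0, 0;
         0, 0, -x, 0, 0, 0, B, z;
         0, 0, 0, 0, -x, 0, -A, -x]
    let M3 : Matrix (Fin 8) (Fin 3) Q :=
      !![Cc, w, 0;
         0, Cc, w;
         -B, -z, 0;
         0, -B, -z;
         A, x, 0;
         0, A, x;
         -x, 0, 0;
         0, -x, 0]
    let d1 : (Fin 6 → Q) →ₗ[Q] Q :=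
      (LinearEquiv.funUnique (Fin 1) Q Q).toLinearMap ∘ₗ Matrix.toLin' M1
    let d2 : (Fin 8 → Q) →ₗ[Q] (Fin 6 → Q) := Matrix.toLin' M2
    let d3 : (Fin 3 → Q) →ₗ[Q] (Fin 8 → Q) := Matrix.toLin' M3
    -- `J` is the ideal of 2×2 minors of `M`
    J = Ideal.span {d : Q | ∃ i j : Fin 4, i < j ∧
          d = M 0 i * M 1 j - M 0 j * M 1 i} ∧
    -- `J` contains a regular sequence of length three, and the length-three free
    -- resolution below shows that `J` is perfect of grade three
    (∃ rs : List Q, rs.length = 3 ∧ RingTheory.Sequence.IsRegular Q rs ∧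
        ∀ r ∈ rs, r ∈ J) ∧
    -- the Eagon–Northcott complex `0 → Q³ → Q⁸ → Q⁶ → Q` is exact and resolves `Q/J`
    Function.Injective d3 ∧
    LinearMap.range d3 = LinearMap.ker d2 ∧
    LinearMap.range d2 = LinearMap.ker d1 ∧
    LinearMap.range d1 = J ∧
    -- the resolution is graded minimal with twists `0 → Q³(−4) → Q⁸(−3) → Q⁶(−2) → Q`
    (∀ j, (M1 0 j).IsHomogeneous 2) ∧
    (∀ i j, (M2 i j).IsHomogeneous 1) ∧
    (∀ i j, (M3 i j).IsHomogeneous 1) := by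
  intro Q x y z w A B Cc J M M1 M2 M3 d1 d2 d3
  have hd1 : ∀ a, d1 a = x ^ 2 * a 0 + x * z * a 1 + y * z * a 2 + x * w * a 3
      + (w * y - x * z) * a 4 - z ^ 2 * a 5 := by
    intro a
    simp [d1, M1, A, B, Cc, Matrix.mulVec, dotProduct, Fin.sum_univ_succ]
    ring
  have hd2 : ∀ v, d2 v = ![- z * v 1 - z * v 2 - w * v 3,
      y * v 0 + x * v 1 - z * v 4 - w * v 5, - x * v 0 - z * v 6 - w * v 7,
      y * v 2 + x * v 3 + z * v 5, - x * v 2 + z * v 7, - x * v 4 - y * v 6 - x * v 7] := by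
    intro v
    ext1 i
    fin_cases i <;>
      simp [d2, M2, A, B, Cc, Matrix.mulVec, dotProduct, Fin.sum_univ_succ] <;> ring
  have hd3 : ∀ c, d3 c = ![z * c 0 + w * c 1, z * c 1 + w * c 2, - z * c 1, - z * c 2,
      y * c 0 + x * c 1, y * c 1 + x * c 2, - x * c 0, - x * c 1] := by
    intro v
    ext1 i
    fin_cases i <;>
      simp [d3, M3, A, B, Cc, Matrix.mulVec, dotProduct, Fin.sum_univ_succ]
  have hx0 : x ≠ 0 := X_ne_zero 0
  clear_value d1 d2 d3
  have J1 : x ^ 2 ∈ J := Ideal.subset_span (by simp)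
  have J2 : x * z ∈ J := Ideal.subset_span (by simp)
  have J3 : x * w ∈ J := Ideal.subset_span (by simp)
  have J4 : y * z ∈ J := Ideal.subset_span (by simp)
  have J5 : y * w ∈ J := Ideal.subset_span (by simp)
  have J6 : z ^ 2 ∈ J := Ideal.subset_span (by simp)
  refine ⟨?_, ⟨_, rfl, regular_seq, ?_⟩, ?_, ?_, ?_, ?_, ?_, ?_, ?_⟩
  · apply le_antisymm
    · have key : ∀ i j : Fin 4, i < j → M 0 i * M 1 j - M 0 j * M 1 i ∈
          Ideal.span {d : Q | ∃ i j : Fin 4, i < j ∧ d = M 0 i * M 1 j - M 0 j * M 1 i} :=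
        fun i j h => Ideal.subset_span ⟨i, j, h, rfl⟩
      have k01 := key 0 1 (by decide)
      have k02 := key 0 2 (by decide)
      have k03 := key 0 3 (by decide)
      have k12 := key 1 2 (by decide)
      have k13 := key 1 3 (by decide)
      have k23 := key 2 3 (by decide)
      generalize Ideal.span {d : Q | ∃ i j : Fin 4, i < j ∧
        d = M 0 i * M 1 j - M 0 j * M 1 i} = I at *
      simp [M, A, B, Cc] at k01 k02 k03 k12 k13 k23
      rw [Ideal.span_le]
      intro r hr
      simp only [Set.mem_insert_iff, Set.mem_singleton_iff] at hr
      rcases hr with rfl | rfl | rfl | rfl | rfl | rfl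
      · simpa [sq] using k01
      · exact k02
      · exact k03
      · exact k12
      · have := I.add_mem k13 k02
        rwa [mul_comm z x, sub_add_cancel] at this
      · have := I.neg_mem k23
        rwa [neg_neg, ← sq] at this
    · rw [Ideal.span_le]
      rintro d ⟨i, j, hij, rfl⟩
      have J7 : y * w - z * x ∈ J := by
        rw [mul_comm z x]
        exact J.sub_mem J5 J2
      have J1' : x * x ∈ J := by rwa [← sq]
      have J6' : -(z * z) ∈ J := J.neg_mem (by rwa [← sq])
      fin_cases i <;> fin_cases j <;> first
        | exact absurd hij (by decide)
        | (simp [M, A, B, Cc]; assumption)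
  · intro r hr
    simp only [List.mem_cons, List.not_mem_nil, or_false] at hr
    rcases hr with rfl | rfl | rfl
    · exact J1
    · exact J6
    · exact J5
  · rw [← LinearMap.ker_eq_bot, LinearMap.ker_eq_bot']
    intro c hc
    rw [hd3] at hc
    have h6 := congrFun hc 6
    have h7 := congrFun hc 7
    have h5 := congrFun hc 5
    simp [hx0] at h5 h6 h7
    simp [h7, hx0] at h5
    ext1 i
    fin_cases i <;> simp [*]
  · apply le_antisymm
    · rintro _ ⟨c, rfl⟩
      rw [LinearMap.mem_ker, hd3, hd2]
      ext1 i
      fin_cases i <;> simp <;> ring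
    · intro v hv
      rw [LinearMap.mem_ker, hd2] at hv
      obtain ⟨c1, c2, c3, h⟩ := EN_exact2 x y z w rfl rfl rfl rfl
        (v 0) (v 1) (v 2) (v 3) (v 4) (v 5) (v 6) (v 7)
        (congrFun hv 0) (congrFun hv 2) (congrFun hv 3) (congrFun hv 4) (congrFun hv 5)
      obtain ⟨h0, h1, h2, h3, h4, h5, h6, h7⟩ := h
      refine ⟨![c1, c2, c3], ?_⟩
      rw [hd3]
      ext1 i
      fin_cases i
      · exact h0.symm
      · exact h1.symm
      · exact h2.symm
      · exact h3.symm
      · exact h4.symm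
      · exact h5.symm
      · exact h6.symm
      · exact h7.symm
  · apply le_antisymm
    · rintro _ ⟨v, rfl⟩
      rw [LinearMap.mem_ker, hd2, hd1]
      simp
      ring
    · intro a ha
      rw [LinearMap.mem_ker, hd1] at ha
      obtain ⟨v1, v2, v3, v4, v5, v6, v7, v8, h0, h1, h2, h3, h4, h5⟩ :=
        EN_exact1 x y z w rfl rfl rfl rfl _ _ _ _ _ _ ha
      refine ⟨![v1, v2, v3, v4, v5, v6, v7, v8], ?_⟩
      rw [hd2]
      ext1 i
      fin_cases i
      · exact h0.symm
      · exact h1.symm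
      · exact h2.symm
      · exact h3.symm
      · exact h4.symm
      · exact h5.symm
  · apply le_antisymm
    · rintro _ ⟨a, rfl⟩
      rw [hd1]
      have J7 : w * y - x * z ∈ J := by
        rw [mul_comm w y]
        exact J.sub_mem J5 J2
      exact J.sub_mem (J.add_mem (J.add_mem (J.add_mem (J.add_mem (J.mul_mem_right _ J1)
        (J.mul_mem_right _ J2)) (J.mul_mem_right _ J4)) (J.mul_mem_right _ J3))
        (J.mul_mem_right _ J7)) (J.mul_mem_right _ J6)
    · refine Ideal.span_le.2 ?_
      intro r hr
      simp only [Set.mem_insert_iff, Set.mem_singleton_iff] at hr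
      rcases hr with rfl | rfl | rfl | rfl | rfl | rfl
      · exact ⟨![1, 0, 0, 0, 0, 0], by rw [hd1]; simp⟩
      · exact ⟨![0, 1, 0, 0, 0, 0], by rw [hd1]; simp⟩
      · exact ⟨![0, 0, 0, 1, 0, 0], by rw [hd1]; simp⟩
      · exact ⟨![0, 0, 1, 0, 0, 0], by rw [hd1]; simp⟩
      · exact ⟨![0, 1, 0, 0, 1, 0], by rw [hd1]; simp; ring⟩
      · exact ⟨![0, 0, 0, 0, 0, -1], by rw [hd1]; simp; ring⟩
  · have hx : x.IsHomogeneous 1 := isHomogeneous_X k 0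
    have hy : y.IsHomogeneous 1 := isHomogeneous_X k 1
    have hz : z.IsHomogeneous 1 := isHomogeneous_X k 2
    have hw : w.IsHomogeneous 1 := isHomogeneous_X k 3
    have h0 : (0 : Q).IsHomogeneous 1 := isHomogeneous_zero _ _ _
    intro j
    fin_cases j
    · exact hx.pow 2
    · exact hx.mul hz
    · exact (hz.mul hy).sub (hx.mul h0)
    · exact hx.mul hw
    · exact (hw.mul hy).sub (hx.mul hz)
    · exact (hw.mul h0).sub (hz.mul hz)
  all_goals
    have hx : x.IsHomogeneous 1 := isHomogeneous_X k 0
    have hy : y.IsHomogeneous 1 := isHomogeneous_X k 1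
    have hz : z.IsHomogeneous 1 := isHomogeneous_X k 2
    have hw : w.IsHomogeneous 1 := isHomogeneous_X k 3
    have h0 : (0 : Q).IsHomogeneous 1 := isHomogeneous_zero _ _ _
    intro i j
    fin_cases i <;> fin_cases j <;> first
      | exact h0
      | exact hx
      | exact hy
      | exact hz
      | exact hw
      | exact hx.neg
      | exact hy.neg
      | exact hz.neg
      | exact hw.neg
      | exact h0.neg
end
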